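/- Let R be a filtered K-algebra with an exhaustive increasing ℤ-indexed filtration F_•R (K-subspaces with 1 ∈ F_0R and F_iR·F_jR ⊆ F_{i+j}R), let T ⊆ R be a K-subalgebra with the induced filtration F_•T = T ∩ F_•R, let N be an R-module with an exhaustive increasing filtration F_•N satisfying F_iR·F_jN ⊆ F_{i+j}N, let P ⊆ N be an R-submodule and U ⊆ N a T-submodule. Equip Q = (U+P)/P with the two F_•T-module filtrations F^{q(U)}_•Q = ((F_•N ∩ U) + P)/P and F^s_•Q = ((F_•N + P)/P) ∩ Q. Then F^{q(U)}_•Q = F^s_•Q if and only if gr^F(U∩P) = gr^F U ∩ gr^F P, under the natural identification of gr^F(U∩P), gr^F U and gr^F P with graded submodules of gr^F N (where U, P and U∩P carry the filtrations induced from F_•N). -/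

import Mathlib

namespace Submodule

variable {K N : Type*} [Ring K] [AddCommGroup N] [Module K N]

/-- The image of `F ⊓ U` in `N ⧸ P` is the intersection of the images of `F` and `U` if and only
if every element of `U` congruent to an element of `F` modulo `P` is congruent to an element of
`F ⊓ U`. -/
theorem map_mkQ_inf_eq_iff (P F U : Submodule K N) :
    map P.mkQ (F ⊓ U) = map P.mkQ F ⊓ map P.mkQ U ↔
      ∀ u ∈ U, ∀ x ∈ F, u - x ∈ P → ∃ v ∈ F ⊓ U, u - v ∈ P := by
  constructor
  · intro h u hu x hx hux
    have hmem : P.mkQ u ∈ map P.mkQ F ⊓ map P.mkQ U :=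
      ⟨⟨x, hx, ((Quotient.eq P).2 hux).symm⟩, ⟨u, hu, rfl⟩⟩
    rw [← h] at hmem
    obtain ⟨v, hv, hvu⟩ := hmem
    exact ⟨v, hv, (Quotient.eq P).1 hvu.symm⟩
  · intro h
    refine le_antisymm (map_inf_le _) ?_
    rintro _ ⟨⟨x, hx, rfl⟩, ⟨u, hu, hux⟩⟩
    obtain ⟨v, hv, huv⟩ := h u hu x hx ((Quotient.eq P).1 hux)
    exact ⟨v, hv, ((Quotient.eq P).2 huv).symm.trans hux⟩

/-- The symbols of `F ⊓ U ⊓ P` modulo `G` are the common symbols of `F ⊓ U` and `F ⊓ P` if and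
only if every element of `F ⊓ U` congruent to an element of `P` modulo `G` is congruent to an
element of `F ⊓ U ⊓ P`. -/
theorem inf_sup_inf_inf_sup_eq_iff {F G : Submodule K N} (hGF : G ≤ F) (P U : Submodule K N) :
    ((F ⊓ U) ⊔ G) ⊓ ((F ⊓ P) ⊔ G) = (F ⊓ U ⊓ P) ⊔ G ↔
      ∀ u ∈ F ⊓ U, ∀ p ∈ P, u - p ∈ G → ∃ w ∈ F ⊓ U ⊓ P, u - w ∈ G := by
  constructor
  · intro h u hu p hp hup
    have hpF : p ∈ F := by simpa using F.sub_mem hu.1 (hGF hup)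
    have hmem : u ∈ ((F ⊓ U) ⊔ G) ⊓ ((F ⊓ P) ⊔ G) :=
      ⟨mem_sup_left hu, mem_sup.2 ⟨p, ⟨hpF, hp⟩, u - p, hup, by abel⟩⟩
    rw [h] at hmem
    obtain ⟨w, hw, g, hg, rfl⟩ := mem_sup.1 hmem
    exact ⟨w, hw, by simpa using hg⟩
  · intro h
    refine le_antisymm ?_ (le_inf (sup_le_sup_right inf_le_left _)
      (sup_le_sup_right (inf_le_inf_right _ inf_le_left) _))
    rintro _ ⟨hx, hx'⟩
    obtain ⟨u, hu, g, hg, rfl⟩ := mem_sup.1 hx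
    obtain ⟨p, hp, g', hg', hpg⟩ := mem_sup.1 hx'
    have hup : u - p ∈ G := by
      have : u - p = g' - g := by
        rw [sub_eq_sub_iff_add_eq_add, ← hpg, add_comm]
      exact this ▸ G.sub_mem hg' hg
    obtain ⟨w, hw, huw⟩ := h u hu p hp.2 hup
    exact mem_sup.2 ⟨w, hw, (u - w) + g, G.add_mem huw hg, by abel⟩

/-- If every graded symbol common to `U` and `P` comes from `U ⊓ P`, then an element of `U` in
filtration degree `k + n` congruent modulo `P` to an element of degree `k` is congruent to an
element of `U` of degree `k`. -/
theorem exists_mem_inf_sub_mem_of_graded {F : ℤ → Submodule K N} (hF : Monotone F)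
    {P U : Submodule K N}
    (h : ∀ k, ∀ u ∈ F k ⊓ U, ∀ p ∈ P, u - p ∈ F (k - 1) →
      ∃ w ∈ F k ⊓ U ⊓ P, u - w ∈ F (k - 1)) (k : ℤ) (n : ℕ) :
    ∀ u ∈ F (k + n) ⊓ U, ∀ x ∈ F k, u - x ∈ P → ∃ v ∈ F k ⊓ U, u - v ∈ P := by
  induction n with
  | zero =>
    intro u hu x _ _
    exact ⟨u, by simpa using hu, by simp⟩
  | succ n ih =>
    intro u hu x hx hux
    have hdeg : k + ((n + 1 : ℕ) : ℤ) - 1 = k + n := by push_cast; ring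
    obtain ⟨w, hw, huw⟩ := h _ u hu (u - x) hux
      (by rw [sub_sub_cancel, hdeg]; exact hF (by lia) hx)
    rw [hdeg] at huw
    obtain ⟨v, hv, huv⟩ := ih (u - w) ⟨huw, U.sub_mem hu.2 hw.1.2⟩ x hx
      (by simpa [sub_right_comm] using P.sub_mem hux hw.2)
    refine ⟨v, hv, ?_⟩
    have := P.add_mem huv hw.2
    rwa [sub_right_comm, sub_add_cancel] at this

end Submodule

/-- Proposition 442. Let `R` be a filtered `K`-algebra with exhaustive
increasing `ℤ`-indexed filtration `F_•R`, `T ⊆ R` a `K`-subalgebra (with the induced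
filtration), `N` an `R`-module with an exhaustive increasing compatible filtration `F_•N`,
`P ⊆ N` an `R`-submodule and `U ⊆ N` a `T`-submodule.  Equip `Q = (U+P)/P` with the two
filtrations `F^{q(U)}_•Q = ((F_•N ∩ U) + P)/P` and `F^s_•Q = ((F_•N + P)/P) ∩ Q`.  Then
`F^{q(U)}_•Q = F^s_•Q` if and only if `gr^F(U ∩ P) = gr^F U ∩ gr^F P` inside `gr^F N`
(expressed via the canonical preimages in `N`). -/
theorem statement19 {K R N : Type*} [Field K] [Ring R] [Algebra K R]
    [AddCommGroup N] [Module K N] [Module R N] [IsScalarTower K R N]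
    -- the filtration on `R`
    (FR : ℤ → Submodule K R) (hFRmono : Monotone FR)
    (hFRexh : ∀ r : R, ∃ k, r ∈ FR k) (hFRone : (1 : R) ∈ FR 0)
    (hFRmul : ∀ i j : ℤ, ∀ a ∈ FR i, ∀ b ∈ FR j, a * b ∈ FR (i + j))
    -- the subalgebra `T` (with filtration induced from `F_•R`)
    (T : Subalgebra K R)
    -- the filtration on `N`
    (FN : ℤ → Submodule K N) (hFNmono : Monotone FN)
    (hFNexh : ∀ x : N, ∃ k, x ∈ FN k)
    (hFNsmul : ∀ i j : ℤ, ∀ r ∈ FR i, ∀ x ∈ FN j, r • x ∈ FN (i + j))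
    -- an `R`-submodule `P` and a `T`-submodule `U` of `N`
    (P : Submodule R N)
    (U : Submodule K N) (hU : ∀ t ∈ T, ∀ x ∈ U, t • x ∈ U) :
    -- `F^{q(U)}_• Q = F^s_• Q` ...
    (∀ k : ℤ, Submodule.map (P.restrictScalars K).mkQ (FN k ⊓ U) =
        Submodule.map (P.restrictScalars K).mkQ (FN k) ⊓
          Submodule.map (P.restrictScalars K).mkQ U) ↔
    -- ... iff `gr^F (U ∩ P) = gr^F U ∩ gr^F P` inside `gr^F N`
    (∀ k : ℤ, ((FN k ⊓ U) ⊔ FN (k - 1)) ⊓ ((FN k ⊓ P.restrictScalars K) ⊔ FN (k - 1)) =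
        ((FN k ⊓ U ⊓ P.restrictScalars K) ⊔ FN (k - 1))) := by
  simp only [Submodule.map_mkQ_inf_eq_iff,
    fun k => Submodule.inf_sup_inf_inf_sup_eq_iff (hFNmono (sub_one_lt k).le)
      (P.restrictScalars K) U]
  constructor
  · intro h k u hu p hp hup
    obtain ⟨v, hv, huv⟩ := h (k - 1) u hu.2 (u - p) hup (by simpa using hp)
    exact ⟨u - v, ⟨(FN k ⊓ U).sub_mem hu ⟨hFNmono (sub_one_lt k).le hv.1, hv.2⟩, huv⟩,
      by simpa using hv.1⟩
  · intro h k u hu x hx hux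
    obtain ⟨m, hm⟩ := hFNexh u
    exact Submodule.exists_mem_inf_sub_mem_of_graded hFNmono h k (m - k).toNat u
      ⟨hFNmono (by lia) hm, hu⟩ x hx hux
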